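/- Let k ≥ 3. Then: (1) λ₂(𝓛(P_{4k})) < λ₂(𝓛(P_{2k,k})); (2) λ₂(𝓛(R_{2k,k})) < λ₂(𝓛(P_{4k})); and (3) the second smallest eigenvalue of 𝓛(R_{2k,k}) is simple. -/

import Mathlib

open Finset

/-- The degree of vertex `i` in a weighted graph with weight matrix `W`. -/
noncomputable def wdeg {V : Type} [Fintype V] (W : Matrix V V ℝ) (i : V) : ℝ := ∑ j, W i j

/-- The normalized Laplacian `D^{-1/2}(D - W)D^{-1/2}` of a weighted graph. -/
noncomputable def normLap {V : Type} [Fintype V] [DecidableEq V] (W : Matrix V V ℝ) :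
    Matrix V V ℝ :=
  Matrix.of fun i j =>
    ((if i = j then wdeg W i else 0) - W i j) /
      (Real.sqrt (wdeg W i) * Real.sqrt (wdeg W j))

/-- The weight (adjacency) matrix of the unweighted path graph `P_n` on vertices
`0, 1, ..., n-1`, with edges between consecutive vertices. -/
noncomputable def pathW (n : ℕ) : Matrix (Fin n) (Fin n) ℝ :=
  Matrix.of fun i j => if i.val + 1 = j.val ∨ j.val + 1 = i.val then 1 else 0

/-- The weight matrix of the weighted path `P_{n,k}`: a path on `n + k` vertices with
unit edge weights, together with a self-loop of weight `1` at each of the last `k`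
vertices. -/
noncomputable def wpathW (n k : ℕ) : Matrix (Fin (n + k)) (Fin (n + k)) ℝ :=
  Matrix.of fun i j =>
    (if i.val + 1 = j.val ∨ j.val + 1 = i.val then 1 else 0) +
      (if i = j ∧ n ≤ i.val then 1 else 0)

/-- The weight (adjacency) matrix of the roach graph `R_{n,k}`: vertices
`0, ..., n+k-1` are the path `x_1, ..., x_{n+k}` and vertices `n+k, ..., 2(n+k)-1`
are the path `y_1, ..., y_{n+k}`, with rung edges `(x_i, y_i)` for
`n + 1 ≤ i ≤ n + k`. -/
noncomputable def roachW (n k : ℕ) :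
    Matrix (Fin (2 * (n + k))) (Fin (2 * (n + k))) ℝ :=
  Matrix.of fun i j =>
    if ((i.val + 1 = j.val ∧ j.val ≠ n + k) ∨ (j.val + 1 = i.val ∧ i.val ≠ n + k))
        ∨ ((i.val + (n + k) = j.val ∧ n ≤ i.val) ∨ (j.val + (n + k) = i.val ∧ n ≤ j.val))
      then 1 else 0

/-- The eigenvalues of a Hermitian matrix sorted in increasing order. -/
noncomputable def sortedEig {n : ℕ} {A : Matrix (Fin n) (Fin n) ℝ} (hA : A.IsHermitian) :
    Fin n → ℝ :=
  hA.eigenvalues ∘ Tuple.sort hA.eigenvalues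


theorem sortedEig_monotone {n : ℕ} {A : Matrix (Fin n) (Fin n) ℝ} (hA : A.IsHermitian) :
    Monotone (sortedEig hA) :=
  Tuple.monotone_sort _

/-- An orthonormal eigenbasis listed in the order of the sorted eigenvalues. -/
theorem exists_sortedEig_basis {n : ℕ} {A : Matrix (Fin n) (Fin n) ℝ} (hA : A.IsHermitian) :
    ∃ e : Fin n → Fin n → ℝ, (∀ i, A.mulVec (e i) = sortedEig hA i • e i) ∧
      (∀ i j, e i ⬝ᵥ e j = if i = j then 1 else 0) ∧
      ∀ v w : Fin n → ℝ, v ⬝ᵥ w = ∑ i, (e i ⬝ᵥ v) * (e i ⬝ᵥ w) := by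
  set b := hA.eigenvectorBasis.reindex (Tuple.sort hA.eigenvalues).symm with hb
  refine ⟨fun i => (b i).ofLp, fun i => ?_, fun i j => ?_, fun v w => ?_⟩
  · simpa [hb, sortedEig] using
      hA.mulVec_eigenvectorBasis (Tuple.sort hA.eigenvalues i)
  · have h := orthonormal_iff_ite.1 b.orthonormal i j
    rw [EuclideanSpace.inner_eq_star_dotProduct] at h
    rw [dotProduct_comm]
    simpa using h
  · have h := b.sum_inner_mul_inner (WithLp.toLp 2 v) (WithLp.toLp 2 w)
    simp only [EuclideanSpace.inner_eq_star_dotProduct, star_trivial] at h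
    rw [dotProduct_comm v w, ← h]
    refine Finset.sum_congr rfl fun i _ => ?_
    rw [dotProduct_comm w]

/-- Upper bound for the second smallest eigenvalue by a test vector orthogonal to the kernel. -/
theorem sortedEig_one_lt_of_test {n : ℕ} {A : Matrix (Fin n) (Fin n) ℝ} (hA : A.IsHermitian)
    (hn : 1 < n) {s v : Fin n → ℝ} {t : ℝ} (ht : 0 < t) (hs : s ≠ 0) (hAs : A.mulVec s = 0)
    (hsv : s ⬝ᵥ v = 0) (hv : v ⬝ᵥ A.mulVec v < t * (v ⬝ᵥ v)) :
    sortedEig hA ⟨1, hn⟩ < t := by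
  by_contra! hle
  obtain ⟨e, he, -, hpars⟩ := exists_sortedEig_basis hA
  have hmono := sortedEig_monotone hA
  have hAT : A.transpose = A := by simpa using hA.eq
  have hsymm : ∀ i (u : Fin n → ℝ), e i ⬝ᵥ A.mulVec u = sortedEig hA i * (e i ⬝ᵥ u) := by
    intro i u
    rw [Matrix.dotProduct_mulVec, ← Matrix.mulVec_transpose, hAT, he, smul_dotProduct, smul_eq_mul]
  have hbig : ∀ i : Fin n, i ≠ ⟨0, by omega⟩ → t ≤ sortedEig hA i := fun i hi =>
    hle.trans (hmono (Fin.mk_le_of_le_val (by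
      have : i.val ≠ 0 := fun h => hi (Fin.ext h)
      omega)))
  have hes : ∀ i : Fin n, i ≠ ⟨0, by omega⟩ → e i ⬝ᵥ s = 0 := by
    intro i hi
    have h := hsymm i s
    rw [hAs, dotProduct_zero] at h
    have := hbig i hi
    rcases mul_eq_zero.1 h.symm with h | h
    · linarith
    · exact h
  have hss := hpars s s
  rw [Finset.sum_eq_single ⟨0, by omega⟩ (fun i _ hi => by rw [hes i hi, zero_mul]) (by simp)]
    at hss
  have hsv' := hpars s v
  rw [Finset.sum_eq_single ⟨0, by omega⟩ (fun i _ hi => by rw [hes i hi, zero_mul]) (by simp),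
    hsv] at hsv'
  have hs0 : e ⟨0, by omega⟩ ⬝ᵥ s ≠ 0 := by
    intro h
    rw [h, zero_mul] at hss
    exact hs (dotProduct_self_eq_zero.1 hss)
  have hv0 : e ⟨0, by omega⟩ ⬝ᵥ v = 0 := (mul_eq_zero.1 hsv'.symm).resolve_left hs0
  rw [hpars v (A.mulVec v), hpars v v, Finset.mul_sum] at hv
  refine absurd hv (not_lt.2 (Finset.sum_le_sum fun i _ => ?_))
  rw [hsymm]
  by_cases hi : i = ⟨0, by omega⟩
  · rw [hi, hv0]; simp
  · nlinarith [hbig i hi, mul_self_nonneg (e i ⬝ᵥ v)]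

/-- The eigenvectors of a Hermitian matrix for eigenvalues up to the second smallest one do not
all lie on one line. -/
theorem not_forall_eigenvector_mem_line {n : ℕ} {A : Matrix (Fin n) (Fin n) ℝ}
    (hA : A.IsHermitian) (hn : 1 < n) (s : Fin n → ℝ) :
    ¬ ∀ μ ≤ sortedEig hA ⟨1, hn⟩, ∀ v : Fin n → ℝ, A.mulVec v = μ • v → ∃ c : ℝ, v = c • s := by
  intro h
  obtain ⟨e, he, hort, -⟩ := exists_sortedEig_basis hA
  obtain ⟨c, hc⟩ := h _ (sortedEig_monotone hA (Fin.mk_le_of_le_val (Nat.zero_le _)))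
    _ (he ⟨0, by omega⟩)
  obtain ⟨c', hc'⟩ := h _ le_rfl _ (he ⟨1, hn⟩)
  have h0 := hort ⟨0, by omega⟩ ⟨0, by omega⟩
  have h1 := hort ⟨1, hn⟩ ⟨1, hn⟩
  have h01 := hort ⟨0, by omega⟩ ⟨1, hn⟩
  rw [hc] at h0 h01
  rw [hc'] at h1 h01
  simp at h0 h1 h01
  rcases h01 with h | h | h <;> simp [h] at h0 h1

theorem exists_eigenvector_sortedEig {n : ℕ} {A : Matrix (Fin n) (Fin n) ℝ}
    (hA : A.IsHermitian) (i : Fin n) :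
    ∃ u : Fin n → ℝ, u ≠ 0 ∧ A.mulVec u = sortedEig hA i • u := by
  obtain ⟨e, he, hort, -⟩ := exists_sortedEig_basis hA
  refine ⟨e i, fun h => ?_, he i⟩
  have := hort i i
  simp [h] at this

section WeightedGraph

variable {V : Type} [Fintype V] {W : Matrix V V ℝ}

theorem normLap_mulVec_sqrt [DecidableEq V] (hW : ∀ i, 0 < wdeg W i) (f : V → ℝ) (i : V) :
    (normLap W).mulVec (fun j => √(wdeg W j) * f j) i =
      (wdeg W i * f i - ∑ j, W i j * f j) / √(wdeg W i) := by
  have hterm : ∀ j, normLap W i j * (√(wdeg W j) * f j) =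
      ((if i = j then wdeg W i * f j else 0) - W i j * f j) / √(wdeg W i) := by
    intro j
    have hi := Real.sqrt_pos.2 (hW i)
    have hj := Real.sqrt_pos.2 (hW j)
    simp only [normLap, Matrix.of_apply]
    field_simp
    split_ifs with h
    · subst h; ring
    · ring
  rw [Matrix.mulVec, dotProduct, Finset.sum_congr rfl fun j _ => hterm j, ← Finset.sum_div,
    Finset.sum_sub_distrib]
  simp

theorem normLap_mulVec_sqrt_eq_smul_iff [DecidableEq V] (hW : ∀ i, 0 < wdeg W i)
    (f : V → ℝ) (μ : ℝ) :
    (normLap W).mulVec (fun j => √(wdeg W j) * f j) = μ • (fun j => √(wdeg W j) * f j) ↔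
      ∀ i, wdeg W i * f i - ∑ j, W i j * f j = μ * (wdeg W i * f i) := by
  rw [funext_iff]
  refine forall_congr' fun i => ?_
  rw [normLap_mulVec_sqrt hW, div_eq_iff (Real.sqrt_pos.2 (hW i)).ne', Pi.smul_apply, smul_eq_mul]
  have : μ * (√(wdeg W i) * f i) * √(wdeg W i) = μ * (wdeg W i * f i) := by
    linear_combination (μ * f i) * Real.mul_self_sqrt (hW i).le
  rw [this]

theorem dotProduct_normLap_mulVec_sqrt [DecidableEq V] (hW : ∀ i, 0 < wdeg W i) (f : V → ℝ) :
    (fun j => √(wdeg W j) * f j) ⬝ᵥ (normLap W).mulVec (fun j => √(wdeg W j) * f j) =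
      ∑ i, f i * (wdeg W i * f i - ∑ j, W i j * f j) := by
  refine Finset.sum_congr rfl fun i _ => ?_
  have := Real.sqrt_pos.2 (hW i)
  rw [normLap_mulVec_sqrt hW]
  field_simp

theorem dotProduct_sqrt_wdeg (hW : ∀ i, 0 < wdeg W i) (f g : V → ℝ) :
    (fun j => √(wdeg W j) * f j) ⬝ᵥ (fun j => √(wdeg W j) * g j) =
      ∑ i, wdeg W i * (f i * g i) := by
  refine Finset.sum_congr rfl fun i _ => ?_
  linear_combination (f i * g i) * Real.mul_self_sqrt (hW i).le

theorem eq_sqrt_wdeg_mul (hW : ∀ i, 0 < wdeg W i) (v : V → ℝ) :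
    v = fun j => √(wdeg W j) * (v j / √(wdeg W j)) := by
  funext j
  rw [mul_div_cancel₀]
  exact (Real.sqrt_pos.2 (hW j)).ne'

theorem normLap_mulVec_sqrt_wdeg [DecidableEq V] (hW : ∀ i, 0 < wdeg W i) :
    (normLap W).mulVec (fun j => √(wdeg W j) * 1) = 0 := by
  have := (normLap_mulVec_sqrt_eq_smul_iff hW (fun _ => 1) 0).2 (fun i => by simp [wdeg])
  rwa [zero_smul] at this

end WeightedGraph

/-- The sum of `f` over the neighbours of `i` in the path on `0, ..., M - 1`. -/
noncomputable def pathNbr (M : ℕ) (f : ℕ → ℝ) (i : ℕ) : ℝ :=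
  (if i + 1 < M then f (i + 1) else 0) + (if i = 0 then 0 else f (i - 1))

/-- The weight of the loop at `i` when all vertices from `n` on carry a loop of weight `1`. -/
noncomputable def loopWeight (n i : ℕ) : ℝ := if n ≤ i then 1 else 0

/-- The degree of `i` in the path on `0, ..., M - 1` with loops from `n` on. -/
noncomputable def loopPathDeg (n M i : ℕ) : ℝ := pathNbr M (fun _ => 1) i + loopWeight n i

/-- The decrease of `f` along the edge `(i - 1, i)` of the path, and `0` outside the path. -/
noncomputable def pathFlux (M : ℕ) (f : ℕ → ℝ) (i : ℕ) : ℝ :=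
  if 0 < i ∧ i < M then f (i - 1) - f i else 0

theorem loopWeight_nonneg (n i : ℕ) : 0 ≤ loopWeight n i := by
  unfold loopWeight; split_ifs <;> norm_num

theorem loopPathDeg_pos {n M : ℕ} (hM : 2 ≤ M) (i : ℕ) : 0 < loopPathDeg n M i := by
  have h := loopWeight_nonneg n i
  unfold loopPathDeg pathNbr
  split_ifs <;> linarith

theorem pathFlux_succ_sub (M : ℕ) (f : ℕ → ℝ) {i : ℕ} (hi : i < M) :
    pathFlux M f (i + 1) - pathFlux M f i =
      pathNbr M (fun _ => 1) i * f i - pathNbr M f i := by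
  unfold pathFlux pathNbr
  rcases i with _ | i
  · by_cases h : 1 < M <;> simp [h]
  · by_cases h : i + 1 + 1 < M <;> simp [h, hi]; ring

theorem pathFlux_eq_sub {M : ℕ} (f : ℕ → ℝ) {i : ℕ} (hi : i + 1 < M) :
    pathFlux M f (i + 1) = f i - f (i + 1) := by
  simp [pathFlux, hi]

theorem pathNbr_add (M : ℕ) (f g : ℕ → ℝ) (i : ℕ) :
    pathNbr M (fun j => f j + g j) i = pathNbr M f i + pathNbr M g i := by
  unfold pathNbr; split_ifs <;> ring

theorem pathNbr_sub (M : ℕ) (f g : ℕ → ℝ) (i : ℕ) :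
    pathNbr M (fun j => f j - g j) i = pathNbr M f i - pathNbr M g i := by
  unfold pathNbr; split_ifs <;> ring

theorem pathNbr_neg (M : ℕ) (f : ℕ → ℝ) (i : ℕ) :
    pathNbr M (fun j => -f j) i = -pathNbr M f i := by
  unfold pathNbr; split_ifs <;> ring

/-- `f` solves `(D - W) f = μ D f` on the path with loops. -/
def IsLoopPathEig (n M : ℕ) (μ : ℝ) (f : ℕ → ℝ) : Prop :=
  ∀ i < M, loopPathDeg n M i * f i - pathNbr M f i - loopWeight n i * f i =
    μ * (loopPathDeg n M i * f i)

/-- `f` solves `(D - W) f = μ D f` for the path with loops of sign `-1`. -/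
def IsNegLoopPathEig (n M : ℕ) (μ : ℝ) (f : ℕ → ℝ) : Prop :=
  ∀ i < M, loopPathDeg n M i * f i - pathNbr M f i + loopWeight n i * f i =
    μ * (loopPathDeg n M i * f i)

/-- Sturm comparison for a three-term recurrence: a solution that vanishes at both ends is
not positive at its first interior point if there is a strict positive supersolution. -/
theorem sturm_comparison_not_pos {N : ℕ} {d γ Γ : ℕ → ℝ} {μ : ℝ} (hN : 2 ≤ N)
    (hd : ∀ i < N, 0 < d i) (hγ0 : γ 0 = 0) (hγN : γ N = 0)
    (hγ : ∀ i, i + 1 < N →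
      (γ (i + 1) - γ i) / d i - (γ (i + 2) - γ (i + 1)) / d (i + 1) = μ * γ (i + 1))
    (hΓ0 : Γ 0 = 0) (hΓpos : ∀ i, i + 1 < N → 0 < Γ (i + 1)) (hΓN : 0 ≤ Γ N)
    (hΓ : ∀ i, i + 1 < N →
      μ * Γ (i + 1) ≤ (Γ (i + 1) - Γ i) / d i - (Γ (i + 2) - Γ (i + 1)) / d (i + 1))
    (hΓlast : ∀ i, i + 2 = N →
      μ * Γ (i + 1) < (Γ (i + 1) - Γ i) / d i - (Γ (i + 2) - Γ (i + 1)) / d (i + 1)) :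
    ¬ 0 < γ 1 := by
  intro h1
  have hstep : ∀ i, (γ (i + 1) * Γ i - γ i * Γ (i + 1)) / d i +
      γ (i + 1) * ((Γ (i + 1) - Γ i) / d i - (Γ (i + 2) - Γ (i + 1)) / d (i + 1)) -
      Γ (i + 1) * ((γ (i + 1) - γ i) / d i - (γ (i + 2) - γ (i + 1)) / d (i + 1)) =
      (γ (i + 2) * Γ (i + 1) - γ (i + 1) * Γ (i + 2)) / d (i + 1) := by
    intro i; ring
  have key : ∀ i, i + 1 < N →
      0 < γ (i + 1) ∧ 0 ≤ (γ (i + 1) * Γ i - γ i * Γ (i + 1)) / d i := by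
    intro i
    induction i with
    | zero => intro _; simp [h1, hγ0, hΓ0]
    | succ i ih =>
      intro hi
      obtain ⟨hpos, hw⟩ := ih (by omega)
      have h := hstep i
      rw [hγ i (by omega)] at h
      have h2 := mul_le_mul_of_nonneg_left (hΓ i (by omega)) hpos.le
      have hw' : 0 ≤ (γ (i + 2) * Γ (i + 1) - γ (i + 1) * Γ (i + 2)) / d (i + 1) := by linarith
      refine ⟨?_, hw'⟩
      have h3 := hw'
      rw [le_div_iff₀ (hd (i + 1) (by omega)), zero_mul] at h3
      have h4 := mul_pos hpos (hΓpos (i + 1) hi)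
      exact pos_of_mul_pos_left (by linarith) (hΓpos i (by omega)).le
  obtain ⟨i, rfl⟩ : ∃ i, N = i + 2 := ⟨N - 2, by omega⟩
  obtain ⟨hpos, hw⟩ := key i (by omega)
  have h := hstep i
  rw [hγ i (by omega), hγN] at h
  have h2 := mul_lt_mul_of_pos_left (hΓlast i rfl) hpos
  have h3 : 0 < (0 * Γ (i + 1) - γ (i + 1) * Γ (i + 2)) / d (i + 1) := by linarith
  have h4 := (div_pos_iff_of_pos_right (hd (i + 1) (by omega))).1 h3
  have h5 := mul_nonneg hpos.le hΓN
  linarith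

/-- `Γ` is a positive supersolution at level `μ` of the equation satisfied by the fluxes of
eigenfunctions on the path with loops. -/
structure IsFluxSupersolution (n M : ℕ) (μ : ℝ) (Γ : ℕ → ℝ) : Prop where
  zero : Γ 0 = 0
  pos : ∀ i, i + 1 < M → 0 < Γ (i + 1)
  last : 0 ≤ Γ M
  le : ∀ i, i + 1 < M → μ * Γ (i + 1) ≤ (Γ (i + 1) - Γ i) / loopPathDeg n M i -
    (Γ (i + 2) - Γ (i + 1)) / loopPathDeg n M (i + 1)
  lt : ∀ i, i + 2 = M → μ * Γ (i + 1) < (Γ (i + 1) - Γ i) / loopPathDeg n M i -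
    (Γ (i + 2) - Γ (i + 1)) / loopPathDeg n M (i + 1)

theorem IsLoopPathEig.pathFlux_sub {n M : ℕ} {μ : ℝ} {f : ℕ → ℝ} (hf : IsLoopPathEig n M μ f)
    {i : ℕ} (hi : i < M) :
    pathFlux M f (i + 1) - pathFlux M f i = loopPathDeg n M i * (μ * f i) := by
  rw [pathFlux_succ_sub M f hi]
  have h := hf i hi
  unfold loopPathDeg at h ⊢
  linarith

theorem IsLoopPathEig.neg {n M : ℕ} {μ : ℝ} {f : ℕ → ℝ} (hf : IsLoopPathEig n M μ f) :
    IsLoopPathEig n M μ (fun i => -f i) := by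
  intro i hi
  rw [pathNbr_neg]
  linarith [hf i hi]

theorem IsNegLoopPathEig.neg {n M : ℕ} {μ : ℝ} {f : ℕ → ℝ} (hf : IsNegLoopPathEig n M μ f) :
    IsNegLoopPathEig n M μ (fun i => -f i) := by
  intro i hi
  rw [pathNbr_neg]
  linarith [hf i hi]

theorem IsLoopPathEig.pathFlux_one_nonpos {n M : ℕ} {μ : ℝ} {f Γ : ℕ → ℝ} (hM : 2 ≤ M)
    (hf : IsLoopPathEig n M μ f) (hΓ : IsFluxSupersolution n M μ Γ) : pathFlux M f 1 ≤ 0 := by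
  refine not_lt.1 (sturm_comparison_not_pos (d := loopPathDeg n M) (μ := μ) hM
    (fun i _ => loopPathDeg_pos hM i) (by simp [pathFlux]) (by simp [pathFlux])
    (fun i hi => ?_) hΓ.zero hΓ.pos hΓ.last hΓ.le hΓ.lt)
  rw [hf.pathFlux_sub (by omega), hf.pathFlux_sub hi, pathFlux_eq_sub f hi,
    mul_div_cancel_left₀ _ (loopPathDeg_pos hM _).ne',
    mul_div_cancel_left₀ _ (loopPathDeg_pos hM _).ne']
  ring

theorem IsLoopPathEig.eq_const {n M : ℕ} {μ : ℝ} {f Γ : ℕ → ℝ} (hM : 2 ≤ M)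
    (hf : IsLoopPathEig n M μ f) (hΓ : IsFluxSupersolution n M μ Γ) : ∀ i < M, f i = f 0 := by
  have h1 : pathFlux M f 1 = 0 := by
    refine le_antisymm (hf.pathFlux_one_nonpos hM hΓ) ?_
    have h := hf.neg.pathFlux_one_nonpos hM hΓ
    rw [pathFlux_eq_sub _ (by omega)] at h ⊢
    linarith
  have h0 : pathFlux M f 0 = 0 := by simp [pathFlux]
  have hμ0 : μ * f 0 = 0 := by
    have h := hf.pathFlux_sub (show 0 < M by omega)
    rw [zero_add, h1, h0, sub_zero] at h
    exact (mul_eq_zero.1 h.symm).resolve_left (loopPathDeg_pos hM _).ne'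
  have key : ∀ i, i < M → f i = f 0 ∧ pathFlux M f i = 0 := by
    intro i
    induction i with
    | zero => exact fun _ => ⟨rfl, h0⟩
    | succ i ih =>
      intro hi
      obtain ⟨h2, h3⟩ := ih (by omega)
      have h := hf.pathFlux_sub (show i < M by omega)
      rw [h2, hμ0, h3, mul_zero, sub_zero] at h
      refine ⟨?_, h⟩
      rw [pathFlux_eq_sub f hi] at h
      linarith
  exact fun i hi => (key i hi).1

theorem IsNegLoopPathEig.pathFlux_sub {n M : ℕ} {μ : ℝ} {f : ℕ → ℝ}
    (hf : IsNegLoopPathEig n M μ f) {i : ℕ} (hi : i < M) :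
    pathFlux M f (i + 1) - pathFlux M f i =
      (μ * loopPathDeg n M i - 2 * loopWeight n i) * f i := by
  rw [pathFlux_succ_sub M f hi]
  have h := hf i hi
  unfold loopPathDeg at h ⊢
  linarith

theorem IsNegLoopPathEig.eq_zero {n M : ℕ} {μ : ℝ} {f : ℕ → ℝ}
    (hf : IsNegLoopPathEig n M μ f) (h0 : f 0 = 0) : ∀ i < M, f i = 0 := by
  have key : ∀ i, i < M → f i = 0 ∧ pathFlux M f i = 0 := by
    intro i
    induction i with
    | zero => exact fun _ => ⟨h0, by simp [pathFlux]⟩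
    | succ i ih =>
      intro hi
      obtain ⟨h2, h3⟩ := ih (by omega)
      have h := hf.pathFlux_sub (show i < M by omega)
      rw [h2, h3, mul_zero, sub_zero] at h
      refine ⟨?_, h⟩
      rw [pathFlux_eq_sub f hi] at h
      linarith
  exact fun i hi => (key i hi).1

theorem IsNegLoopPathEig.not_pos {n M : ℕ} {μ : ℝ} {f : ℕ → ℝ} (hM : 2 ≤ M) (hn : n < M)
    (hμ : μ ≤ 0) (hf : IsNegLoopPathEig n M μ f) : ¬ 0 < f 0 := by
  intro h0
  have hcoef : ∀ i < M, μ * loopPathDeg n M i - 2 * loopWeight n i ≤ 0 := fun i hi => by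
    nlinarith [loopPathDeg_pos (n := n) hM i, loopWeight_nonneg n i]
  have key : ∀ i, i < M → 0 < f i ∧ pathFlux M f i ≤ 0 := by
    intro i
    induction i with
    | zero => exact fun _ => ⟨h0, by simp [pathFlux]⟩
    | succ i ih =>
      intro hi
      obtain ⟨h2, h3⟩ := ih (by omega)
      have h := hf.pathFlux_sub (show i < M by omega)
      have h4 := mul_nonpos_of_nonpos_of_nonneg (hcoef i (by omega)) h2.le
      refine ⟨?_, by linarith⟩
      rw [pathFlux_eq_sub f hi] at h
      linarith
  obtain ⟨m, rfl⟩ : ∃ m, M = m + 1 := ⟨M - 1, by omega⟩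
  obtain ⟨h2, h3⟩ := key m (by omega)
  have h := hf.pathFlux_sub (show m < m + 1 by omega)
  have h4 : pathFlux (m + 1) f (m + 1) = 0 := by simp [pathFlux]
  have h5 : loopWeight n m = 1 := if_pos (by omega)
  rw [h4, h5] at h
  have h6 := mul_pos (loopPathDeg_pos (n := n) hM m) h2
  nlinarith [mul_nonneg (neg_nonneg.2 hμ) h6.le]

theorem IsNegLoopPathEig.eq_zero_of_nonpos {n M : ℕ} {μ : ℝ} {f : ℕ → ℝ} (hM : 2 ≤ M)
    (hn : n < M) (hμ : μ ≤ 0) (hf : IsNegLoopPathEig n M μ f) : ∀ i < M, f i = 0 := by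
  refine hf.eq_zero (le_antisymm (not_lt.1 (hf.not_pos hM hn hμ)) ?_)
  simpa using hf.neg.not_pos hM hn hμ

theorem loopPathDeg_eq (n M i : ℕ) : loopPathDeg n M i =
    (if i + 1 < M then 1 else 0) + (if i = 0 then 0 else 1) + if n ≤ i then 1 else 0 := rfl

/-- The flux of `cos (i θ)` through the edge `(i - 1, i)`, up to a constant. -/
noncomputable def sinFlux (θ : ℝ) (i : ℕ) : ℝ := Real.sin ((i - 1 / 2) * θ)

theorem sinFlux_add (θ : ℝ) (i : ℕ) :
    sinFlux θ i + sinFlux θ (i + 2) = 2 * Real.cos θ * sinFlux θ (i + 1) := by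
  have h1 : ((i : ℝ) - 1 / 2) * θ = (i + 1 - 1 / 2) * θ - θ := by ring
  have h2 : ((i + 2 : ℕ) - 1 / 2 : ℝ) * θ = (i + 1 - 1 / 2) * θ + θ := by push_cast; ring
  simp only [sinFlux]
  rw [h1, h2, Real.sin_sub, Real.sin_add]
  push_cast
  ring

theorem sinFlux_zero (θ : ℝ) : sinFlux θ 0 = -sinFlux θ 1 := by
  simp only [sinFlux]
  rw [← Real.sin_neg]
  congr 1; push_cast; ring

theorem sinFlux_pos {θ : ℝ} (hθ : 0 < θ) {i : ℕ} (hi : (i + 1 / 2 : ℝ) * θ < Real.pi) :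
    0 < sinFlux θ (i + 1) := by
  refine Real.sin_pos_of_pos_of_lt_pi ?_ ?_ <;> push_cast
  · have : (0 : ℝ) ≤ i := i.cast_nonneg
    exact mul_pos (by linarith) hθ
  · linarith

theorem isFluxSupersolution_path {m : ℕ} (hm : 2 ≤ m) {θ μ : ℝ} (hθ : m * θ = Real.pi)
    (hμ : μ < 1 - Real.cos θ) :
    IsFluxSupersolution (m + 1) (m + 1) μ
      (fun i => if i = 0 ∨ i = m + 1 then 0 else sinFlux θ i) := by
  have hm' : (2 : ℝ) ≤ m := by exact_mod_cast hm
  have hθ0 : 0 < θ := by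
    by_contra! h
    nlinarith [Real.pi_pos]
  have hpos : ∀ i, i < m → 0 < sinFlux θ (i + 1) := fun i hi => by
    refine sinFlux_pos hθ0 ?_
    have : (i : ℝ) + 1 ≤ m := by exact_mod_cast hi
    nlinarith
  have hend : sinFlux θ (m + 1) = -sinFlux θ m := by
    have h1 : ((m + 1 : ℕ) - 1 / 2 : ℝ) * θ = θ / 2 + Real.pi := by
      rw [← hθ]; push_cast; ring
    have h2 : ((m : ℝ) - 1 / 2) * θ = Real.pi - θ / 2 := by rw [← hθ]; ring
    rw [sinFlux, sinFlux, h1, h2, Real.sin_add_pi, Real.sin_pi_sub]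
  have key : ∀ i, i + 1 < m + 1 →
      ((if i + 1 = 0 ∨ i + 1 = m + 1 then 0 else sinFlux θ (i + 1)) -
        (if i = 0 ∨ i = m + 1 then 0 else sinFlux θ i)) / loopPathDeg (m + 1) (m + 1) i -
      ((if i + 2 = 0 ∨ i + 2 = m + 1 then 0 else sinFlux θ (i + 2)) -
        (if i + 1 = 0 ∨ i + 1 = m + 1 then 0 else sinFlux θ (i + 1))) /
          loopPathDeg (m + 1) (m + 1) (i + 1) = (1 - Real.cos θ) * sinFlux θ (i + 1) := by
    intro i hi
    have h := sinFlux_add θ i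
    rw [loopPathDeg_eq, loopPathDeg_eq]
    rcases Nat.eq_zero_or_pos i with rfl | hi0
    · have h0 := sinFlux_zero θ
      simp [show ¬ m = 0 by omega, show ¬ m = 1 by omega, show 0 < m by omega, hm] at h ⊢
      norm_num
      linarith
    · rcases Nat.lt_or_ge (i + 1) m with him | him
      · simp [show ¬ i = 0 by omega, show ¬ i = m by omega, show ¬ i = m + 1 by omega,
          show ¬ i + 1 = m by omega, show i < m by omega, him, show ¬ m + 1 ≤ i by omega,
          show ¬ m ≤ i by omega]
        norm_num
        linarith
      · obtain rfl : m = i + 1 := by omega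
        simp [show ¬ i = 0 by omega, show ¬ i = i + 1 + 1 by omega] at h ⊢
        norm_num
        linarith
  have hlt : ∀ i, i + 1 < m + 1 → μ * sinFlux θ (i + 1) < (1 - Real.cos θ) * sinFlux θ (i + 1) :=
    fun i hi => mul_lt_mul_of_pos_right hμ (hpos i (by omega))
  have hΓ : ∀ i, i + 1 < m + 1 →
      (if i + 1 = 0 ∨ i + 1 = m + 1 then 0 else sinFlux θ (i + 1)) = sinFlux θ (i + 1) :=
    fun i hi => if_neg (by omega)
  exact
    { zero := by simp
      pos := fun i hi => by simpa only [hΓ i hi] using hpos i (by omega)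
      last := by simp
      le := fun i hi => by
        rw [key i hi]
        simpa only [hΓ i hi] using (hlt i hi).le
      lt := fun i hi => by
        rw [key i (by omega)]
        simpa only [hΓ i (by omega)] using hlt i (by omega) }

theorem isFluxSupersolution_loopPath {k : ℕ} (hk : 3 ≤ k) {θ μ : ℝ}
    (hθ : (4 * k - 1) * θ = Real.pi) (hμ : μ ≤ 1 - Real.cos θ) :
    IsFluxSupersolution (2 * k) (2 * k + k) μ (fun i => if i = 0 then 0 else
      if i ≤ 2 * k then sinFlux θ i
      else 1 - 3 / 2 * (1 - Real.cos θ) * ((i : ℝ) - 2 * k) ^ 2) := by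
  have hk' : (3 : ℝ) ≤ k := by exact_mod_cast hk
  have hθ0 : 0 < θ := by
    by_contra! h
    nlinarith [Real.pi_pos]
  set a : ℝ := 1 - Real.cos θ with ha
  have ha0 : 0 < a := by
    have := Real.cos_lt_cos_of_nonneg_of_le_pi le_rfl (y := θ) (by nlinarith) hθ0
    rw [Real.cos_zero] at this
    linarith
  have hak : 3 / 2 * a * k ^ 2 < 1 := by
    have h1 := Real.one_sub_sq_div_two_le_cos (x := θ)
    have h2 : a ≤ θ ^ 2 / 2 := by linarith
    have h3 : 11 * (k * θ) ≤ 3 * 3.15 := by nlinarith [Real.pi_lt_d2]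
    have h4 : 0 < k * θ := by positivity
    have h5 : a * k ^ 2 ≤ (k * θ) ^ 2 / 2 := by nlinarith [sq_nonneg (k : ℝ)]
    nlinarith
  have hmid : sinFlux θ (2 * k) = 1 := by
    rw [sinFlux, show ((2 * k : ℕ) - 1 / 2 : ℝ) * θ = Real.pi / 2 by rw [← hθ]; push_cast; ring,
      Real.sin_pi_div_two]
  have hpos1 : ∀ i, i < 2 * k → 0 < sinFlux θ (i + 1) := fun i hi => by
    refine sinFlux_pos hθ0 ?_
    have : (i : ℝ) + 1 ≤ 2 * k := by exact_mod_cast hi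
    nlinarith
  have hpos2 : ∀ x : ℝ, 0 ≤ x → x ≤ k → 0 < 1 - 3 / 2 * a * x ^ 2 := fun x h0 h1 => by
    have : x ^ 2 ≤ (k : ℝ) ^ 2 := by gcongr
    nlinarith
  set Γ : ℕ → ℝ := fun i => if i = 0 then 0 else
      if i ≤ 2 * k then sinFlux θ i else 1 - 3 / 2 * a * ((i : ℝ) - 2 * k) ^ 2 with hΓ
  have hΓ0 : Γ 0 = 0 := by simp [hΓ]
  have hΓ1 : ∀ i, i ≠ 0 → i ≤ 2 * k → Γ i = sinFlux θ i := fun i h0 h1 => by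
    simp [hΓ, h0, h1]
  have hΓ2 : ∀ j : ℕ, Γ (2 * k + j) = 1 - 3 / 2 * a * (j : ℝ) ^ 2 := fun j => by
    rcases Nat.eq_zero_or_pos j with rfl | hj
    · rw [add_zero, hΓ1 _ (by omega) le_rfl, hmid]; simp
    · simp [hΓ, show ¬ j = 0 by omega]
  have hΓpos : ∀ i, i < 2 * k + k → 0 < Γ (i + 1) := fun i hi => by
    rcases Nat.lt_or_ge i (2 * k) with h | h
    · rw [hΓ1 _ (by omega) (by omega)]; exact hpos1 i h
    · obtain ⟨j, rfl⟩ := Nat.exists_eq_add_of_le h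
      rw [add_assoc, hΓ2]
      exact hpos2 _ (by positivity) (by exact_mod_cast (by omega : j + 1 ≤ k))
  have hle1 : ∀ i, i + 1 < 2 * k + k → μ * Γ (i + 1) ≤ a * Γ (i + 1) := fun i hi =>
    mul_le_mul_of_nonneg_right hμ (hΓpos i (by omega)).le
  have hle2 : ∀ x : ℝ, a * (1 - 3 / 2 * a * x ^ 2) ≤ a := fun x => by
    nlinarith [mul_nonneg (mul_nonneg ha0.le ha0.le) (sq_nonneg x)]
  have hlast : ∀ i, i + 2 = 2 * k + k → a * Γ (i + 1) < (Γ (i + 1) - Γ i) /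
      loopPathDeg (2 * k) (2 * k + k) i - (Γ (i + 2) - Γ (i + 1)) /
        loopPathDeg (2 * k) (2 * k + k) (i + 1) := by
    intro i hi
    obtain ⟨j, rfl⟩ : ∃ j, i = 2 * k + j := ⟨i - 2 * k, by omega⟩
    rw [add_assoc, add_assoc, hΓ2, hΓ2, hΓ2, loopPathDeg_eq, loopPathDeg_eq]
    have hj : (1 : ℝ) ≤ j := by exact_mod_cast (by omega : 1 ≤ j)
    simp [show 2 * k + j + 1 < 2 * k + k by omega, show ¬ k = 0 by omega,
      show ¬ 2 * k + (j + 1) + 1 < 2 * k + k by omega]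
    norm_num
    have := hle2 (j + 1)
    nlinarith
  refine ⟨hΓ0, fun i hi => hΓpos i (by omega), ?_, fun i hi => (hle1 i hi).trans ?_,
    fun i hi => (hle1 i (by omega)).trans_lt (hlast i hi)⟩
  · have := hΓpos (2 * k + k - 1) (by omega)
    rw [Nat.sub_add_cancel (by omega)] at this
    exact this.le
  rcases Nat.lt_or_ge (i + 1) (2 * k) with h | h
  · rw [loopPathDeg_eq, loopPathDeg_eq, hΓ1 (i + 1) (by omega) (by omega),
      hΓ1 (i + 2) (by omega) (by omega)]
    have hrec := sinFlux_add θ i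
    rcases Nat.eq_zero_or_pos i with rfl | hi0
    · have h0 := sinFlux_zero θ
      rw [hΓ0]
      simp [show 1 < 2 * k + k by omega, show ¬ k = 0 by omega, show 2 < 2 * k + k by omega,
        show ¬ 2 * k ≤ 1 by omega] at hrec ⊢
      norm_num
      linarith
    · rw [hΓ1 i (by omega) (by omega)]
      simp [show ¬ i = 0 by omega, hi, show i + 1 + 1 < 2 * k + k by omega,
        show ¬ 2 * k ≤ i by omega, show ¬ 2 * k ≤ i + 1 by omega]
      norm_num
      linarith
  · obtain ⟨j, hj⟩ := Nat.exists_eq_add_of_le h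
    rcases Nat.eq_zero_or_pos j with rfl | hj0
    · have hrec : sinFlux θ i = Real.cos θ := by
        rw [sinFlux, show ((i : ℝ) - 1 / 2) * θ = Real.pi / 2 - θ by
          rw [← hθ, show (i : ℝ) = 2 * k - 1 by
            rw [eq_sub_iff_add_eq]; exact_mod_cast hj]
          ring, Real.sin_pi_div_two_sub]
      rw [hΓ1 i (by omega) (by omega), hrec, show i + 2 = 2 * k + 1 by omega, hj, hΓ2, hΓ2,
        loopPathDeg_eq, loopPathDeg_eq]
      simp [hi, show ¬ i = 0 by omega, show ¬ k = 0 by omega, show ¬ 2 * k ≤ i by omega,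
        show 1 < k by omega]
      norm_num
      linarith
    · rcases Nat.lt_or_ge (i + 2) (2 * k + k) with hi2 | hi2
      · obtain ⟨j, rfl⟩ : ∃ j, i = 2 * k + j := ⟨i - 2 * k, by omega⟩
        rw [add_assoc, add_assoc, hΓ2, hΓ2, hΓ2, loopPathDeg_eq, loopPathDeg_eq]
        simp [show 2 * k + j + 1 < 2 * k + k by omega, show ¬ k = 0 by omega,
          show 2 * k + (j + 1) + 1 < 2 * k + k by omega]
        norm_num
        have := hle2 (j + 1)
        linarith
      · exact (hlast i (by omega)).le

theorem sum_range_adj_mul {M i : ℕ} (hi : i < M) (f : ℕ → ℝ) :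
    ∑ j ∈ range M, (if i + 1 = j ∨ j + 1 = i then (1 : ℝ) else 0) * f j = pathNbr M f i := by
  have h1 : ∀ j ∈ range M, (if i + 1 = j ∨ j + 1 = i then (1 : ℝ) else 0) * f j =
      (if i + 1 = j then f j else 0) + (if j + 1 = i then f j else 0) := by
    intro j _
    by_cases h : i + 1 = j
    · simp [h, show ¬ j + 1 = i by omega]
    · simp [h]
  rw [Finset.sum_congr rfl h1, Finset.sum_add_distrib, Finset.sum_ite_eq, pathNbr]
  congr 1
  · simp
  · rcases i with _ | i
    · simp
    · simp [show i < M by omega]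

theorem sum_range_eq_and_mul {M i : ℕ} (hi : i < M) (n : ℕ) (f : ℕ → ℝ) :
    ∑ j ∈ range M, (if i = j ∧ n ≤ i then (1 : ℝ) else 0) * f j = loopWeight n i * f i := by
  rw [Finset.sum_eq_single i (fun j _ hj => by simp [hj.symm]) (by simp [hi])]
  simp [loopWeight]

theorem sum_pathW_mul {N : ℕ} (i : Fin N) (f : ℕ → ℝ) :
    ∑ j : Fin N, pathW N i j * f j = pathNbr N f i := by
  simp only [pathW, Matrix.of_apply]
  rw [Fin.sum_univ_eq_sum_range
    (fun j => (if i.val + 1 = j ∨ j + 1 = i.val then (1 : ℝ) else 0) * f j),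
    sum_range_adj_mul i.isLt]

theorem wdeg_pathW {N : ℕ} (i : Fin N) : wdeg (pathW N) i = loopPathDeg N N i := by
  have h := sum_pathW_mul i (fun _ => 1)
  simp only [mul_one] at h
  rw [wdeg, h, loopPathDeg, loopWeight, if_neg (by omega), add_zero]

theorem sum_wpathW_mul {n k : ℕ} (i : Fin (n + k)) (f : ℕ → ℝ) :
    ∑ j : Fin (n + k), wpathW n k i j * f j =
      pathNbr (n + k) f i + loopWeight n i * f i := by
  simp only [wpathW, Matrix.of_apply, Fin.ext_iff]
  rw [Fin.sum_univ_eq_sum_range (fun j => ((if i.val + 1 = j ∨ j + 1 = i.val then (1 : ℝ) else 0) +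
    (if i.val = j ∧ n ≤ i.val then 1 else 0)) * f j)]
  simp only [add_mul, Finset.sum_add_distrib]
  rw [sum_range_adj_mul i.isLt, sum_range_eq_and_mul i.isLt]

theorem wdeg_wpathW {n k : ℕ} (i : Fin (n + k)) :
    wdeg (wpathW n k) i = loopPathDeg n (n + k) i := by
  have h := sum_wpathW_mul i (fun _ => 1)
  simp only [mul_one] at h
  rw [wdeg, h, loopPathDeg]

theorem sum_roachW_mul {n k : ℕ} (i : Fin (2 * (n + k))) (f : ℕ → ℝ) :
    ∑ j : Fin (2 * (n + k)), roachW n k i j * f j =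
      if i.val < n + k then
        pathNbr (n + k) f i + loopWeight n i * f (n + k + i)
      else
        pathNbr (n + k) (fun j => f (n + k + j)) (i - (n + k)) +
          loopWeight n (i - (n + k)) * f (i - (n + k)) := by
  obtain ⟨i, hi⟩ := i
  simp only [roachW, Matrix.of_apply]
  rw [Fin.sum_univ_eq_sum_range (fun j => (if ((i + 1 = j ∧ j ≠ n + k) ∨
    (j + 1 = i ∧ i ≠ n + k)) ∨ ((i + (n + k) = j ∧ n ≤ i) ∨ (j + (n + k) = i ∧ n ≤ j))
      then (1 : ℝ) else 0) * f j), two_mul, Finset.sum_range_add]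
  split_ifs with h
  · rw [← sum_range_adj_mul h, ← sum_range_eq_and_mul h n (fun j => f (n + k + j))]
    congr 1 <;> refine Finset.sum_congr rfl fun j hj => ?_ <;> congr 1 <;>
      refine if_congr ?_ rfl rfl <;> rw [Finset.mem_range] at hj <;> omega
  · obtain ⟨i, rfl⟩ := Nat.exists_eq_add_of_le (not_lt.1 h)
    have h' : i < n + k := by omega
    rw [Nat.add_sub_cancel_left, ← sum_range_adj_mul h', ← sum_range_eq_and_mul h' n f, add_comm]
    congr 1 <;> refine Finset.sum_congr rfl fun j hj => ?_ <;> congr 1 <;>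
      refine if_congr ?_ rfl rfl <;> rw [Finset.mem_range] at hj <;> omega

theorem wdeg_roachW {n k : ℕ} (i : Fin (2 * (n + k))) : wdeg (roachW n k) i =
    loopPathDeg n (n + k) (if i.val < n + k then i else i - (n + k)) := by
  have h := sum_roachW_mul i (fun _ => 1)
  simp only [mul_one] at h
  rw [wdeg, h]
  split_ifs <;> rfl

theorem wdeg_pathW_pos {N : ℕ} (hN : 2 ≤ N) (i : Fin N) : 0 < wdeg (pathW N) i := by
  rw [wdeg_pathW]; exact loopPathDeg_pos hN _

theorem wdeg_wpathW_pos {n k : ℕ} (h : 2 ≤ n + k) (i : Fin (n + k)) :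
    0 < wdeg (wpathW n k) i := by
  rw [wdeg_wpathW]; exact loopPathDeg_pos h _

theorem wdeg_roachW_pos {n k : ℕ} (h : 2 ≤ n + k) (i : Fin (2 * (n + k))) :
    0 < wdeg (roachW n k) i := by
  rw [wdeg_roachW]; exact loopPathDeg_pos h _

theorem exists_nat_fun_eq {N : ℕ} (f : Fin N → ℝ) : ∃ F : ℕ → ℝ, f = fun j : Fin N => F j :=
  ⟨fun j => if h : j < N then f ⟨j, h⟩ else 0, by funext j; simp⟩

/-- Every vector is the degree-scaled restriction of a function on `ℕ`. -/
theorem exists_eq_sqrt_wdeg_mul {N : ℕ} {W : Matrix (Fin N) (Fin N) ℝ} (hW : ∀ i, 0 < wdeg W i)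
    (v : Fin N → ℝ) : ∃ F : ℕ → ℝ, v = fun j : Fin N => √(wdeg W j) * F j := by
  obtain ⟨F, hF⟩ := exists_nat_fun_eq (fun j => v j / √(wdeg W j))
  refine ⟨F, (eq_sqrt_wdeg_mul hW v).trans (funext fun j => ?_)⟩
  rw [← congrFun hF j]

theorem normLap_pathW_eigenvector_iff {N : ℕ} (hN : 2 ≤ N) (f : ℕ → ℝ) (μ : ℝ) :
    (normLap (pathW N)).mulVec (fun j => √(wdeg (pathW N) j) * f j) =
      μ • (fun j : Fin N => √(wdeg (pathW N) j) * f j) ↔ IsLoopPathEig N N μ f := by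
  rw [normLap_mulVec_sqrt_eq_smul_iff (wdeg_pathW_pos hN) (fun j => f j), Fin.forall_iff]
  refine forall₂_congr fun i hi => ?_
  rw [sum_pathW_mul, wdeg_pathW]
  simp [loopWeight, not_le.2 hi]

theorem normLap_wpathW_eigenvector_iff {n k : ℕ} (h : 2 ≤ n + k) (f : ℕ → ℝ) (μ : ℝ) :
    (normLap (wpathW n k)).mulVec (fun j => √(wdeg (wpathW n k) j) * f j) =
      μ • (fun j : Fin (n + k) => √(wdeg (wpathW n k) j) * f j) ↔
        IsLoopPathEig n (n + k) μ f := by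
  rw [normLap_mulVec_sqrt_eq_smul_iff (wdeg_wpathW_pos h) (fun j => f j), Fin.forall_iff]
  refine forall₂_congr fun i hi => ?_
  rw [sum_wpathW_mul, wdeg_wpathW, sub_sub]

/-- The symmetric and antisymmetric parts of an eigenvector of the roach graph. -/
theorem normLap_roachW_eigenvector_parts {n k : ℕ} (h : 2 ≤ n + k) {f : ℕ → ℝ} {μ : ℝ}
    (hf : (normLap (roachW n k)).mulVec (fun j => √(wdeg (roachW n k) j) * f j) =
      μ • (fun j : Fin (2 * (n + k)) => √(wdeg (roachW n k) j) * f j)) :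
    IsLoopPathEig n (n + k) μ (fun i => f i + f (n + k + i)) ∧
      IsNegLoopPathEig n (n + k) μ (fun i => f i - f (n + k + i)) := by
  rw [normLap_mulVec_sqrt_eq_smul_iff (wdeg_roachW_pos h) (fun j => f j), Fin.forall_iff] at hf
  have key : ∀ i < n + k,
      loopPathDeg n (n + k) i * f i - (pathNbr (n + k) f i + loopWeight n i * f (n + k + i)) =
        μ * (loopPathDeg n (n + k) i * f i) ∧
      loopPathDeg n (n + k) i * f (n + k + i) -
        (pathNbr (n + k) (fun j => f (n + k + j)) i + loopWeight n i * f i) =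
        μ * (loopPathDeg n (n + k) i * f (n + k + i)) := by
    intro i hi
    have h1 := hf i (by omega)
    have h2 := hf (n + k + i) (by omega)
    rw [sum_roachW_mul, wdeg_roachW] at h1 h2
    simp only [hi, if_true] at h1
    simp only [show ¬ n + k + i < n + k by omega, if_false, Nat.add_sub_cancel_left] at h2
    exact ⟨h1, h2⟩
  refine ⟨fun i hi => ?_, fun i hi => ?_⟩
  · obtain ⟨h1, h2⟩ := key i hi
    rw [pathNbr_add]
    linarith
  · obtain ⟨h1, h2⟩ := key i hi
    rw [pathNbr_sub]
    linarith

theorem le_sortedEig_one_pathW {N m : ℕ} (hN : N = m + 1) (hm : 2 ≤ m) {θ : ℝ}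
    (hθ : m * θ = Real.pi) (hA : (normLap (pathW N)).IsHermitian) (h1 : 1 < N) :
    1 - Real.cos θ ≤ sortedEig hA ⟨1, h1⟩ := by
  subst hN
  by_contra! hlt
  refine not_forall_eigenvector_mem_line hA h1
    (fun j => √(wdeg (pathW (m + 1)) j)) fun μ hμ v hv => ?_
  obtain ⟨F, rfl⟩ := exists_eq_sqrt_wdeg_mul (wdeg_pathW_pos (by omega)) v
  have hF := ((normLap_pathW_eigenvector_iff (by omega) F μ).1 hv).eq_const (by omega)
    (isFluxSupersolution_path hm hθ (hμ.trans_lt hlt))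
  refine ⟨F 0, funext fun j => ?_⟩
  rw [hF j j.isLt, Pi.smul_apply, smul_eq_mul, mul_comm]

theorem lt_sortedEig_one_wpathW {k : ℕ} (hk : 3 ≤ k) {θ : ℝ} (hθ : (4 * k - 1) * θ = Real.pi)
    (hA : (normLap (wpathW (2 * k) k)).IsHermitian) (h1 : 1 < 2 * k + k) :
    1 - Real.cos θ < sortedEig hA ⟨1, h1⟩ := by
  by_contra! hle
  refine not_forall_eigenvector_mem_line hA h1
    (fun j => √(wdeg (wpathW (2 * k) k) j)) fun μ hμ v hv => ?_
  obtain ⟨F, rfl⟩ := exists_eq_sqrt_wdeg_mul (wdeg_wpathW_pos (by omega)) v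
  have hF := ((normLap_wpathW_eigenvector_iff (by omega) F μ).1 hv).eq_const (by omega)
    (isFluxSupersolution_loopPath hk hθ (hμ.trans hle))
  refine ⟨F 0, funext fun j => ?_⟩
  rw [hF j j.isLt, Pi.smul_apply, smul_eq_mul, mul_comm]

theorem isLoopPathEig_cos {m : ℕ} (hm : 1 ≤ m) {θ : ℝ} (hθ : m * θ = Real.pi) :
    IsLoopPathEig (m + 1) (m + 1) (1 - Real.cos θ) (fun i => Real.cos (i * θ)) := by
  intro i hi
  have hloop : loopWeight (m + 1) i = 0 := if_neg (by omega)
  have hadd : Real.cos ((i + 1 : ℕ) * θ) =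
      Real.cos (i * θ) * Real.cos θ - Real.sin (i * θ) * Real.sin θ := by
    rw [← Real.cos_add]; congr 1; push_cast; ring
  rw [loopPathDeg, hloop]
  unfold pathNbr
  rcases i with _ | i
  · simp [show 0 < m by omega]
  · have hsub : Real.cos (i * θ) = Real.cos ((i + 1 : ℕ) * θ) * Real.cos θ +
        Real.sin ((i + 1 : ℕ) * θ) * Real.sin θ := by
      rw [← Real.cos_sub]; congr 1; push_cast; ring
    by_cases h : i + 1 + 1 < m + 1
    · simp only [h, if_true, Nat.add_sub_cancel, hadd, hsub, if_neg (Nat.succ_ne_zero i)]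
      ring
    · obtain rfl : m = i + 1 := by omega
      simp only [lt_irrefl, if_false, Nat.add_sub_cancel, hsub, hθ, Real.sin_pi,
        if_neg (Nat.succ_ne_zero i)]
      ring

theorem dotProduct_eq_zero_of_kernel {n : ℕ} {A : Matrix (Fin n) (Fin n) ℝ} (hA : A.IsHermitian)
    {s v : Fin n → ℝ} {μ : ℝ} (hμ : μ ≠ 0) (hs : A.mulVec s = 0) (hv : A.mulVec v = μ • v) :
    s ⬝ᵥ v = 0 := by
  have hAT : A.transpose = A := by simpa using hA.eq
  have h : s ⬝ᵥ A.mulVec v = 0 := by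
    rw [Matrix.dotProduct_mulVec, ← Matrix.mulVec_transpose, hAT, hs, zero_dotProduct]
  rw [hv, dotProduct_smul, smul_eq_mul] at h
  exact (mul_eq_zero.1 h).resolve_left hμ

theorem sortedEig_one_pathW_le {N m : ℕ} (hN : N = m + 1) (hm : 1 ≤ m) {θ : ℝ}
    (hθ : m * θ = Real.pi) (hcos : Real.cos θ < 1) (hA : (normLap (pathW N)).IsHermitian)
    (h1 : 1 < N) :
    sortedEig hA ⟨1, h1⟩ ≤ 1 - Real.cos θ := by
  subst hN
  have hW := wdeg_pathW_pos (N := m + 1) (by omega)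
  set v : Fin (m + 1) → ℝ := fun j => √(wdeg (pathW (m + 1)) j) * Real.cos ((j : ℕ) * θ) with hvdef
  have hv : (normLap (pathW (m + 1))).mulVec v = (1 - Real.cos θ) • v :=
    (normLap_pathW_eigenvector_iff (by omega) (fun i => Real.cos (i * θ)) _).2
      (isLoopPathEig_cos hm hθ)
  have hs := normLap_mulVec_sqrt_wdeg hW
  have hpos : ∀ i, √(wdeg (pathW (m + 1)) i) ≠ 0 := fun i => (Real.sqrt_pos.2 (hW i)).ne'
  have hv0 : v ≠ 0 := fun h => by
    have := congrFun h 0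
    simp [hvdef, hpos] at this
  by_contra! hlt
  refine lt_irrefl _ (sortedEig_one_lt_of_test hA (by omega) (by linarith) (fun h => ?_) hs
    (dotProduct_eq_zero_of_kernel hA (by linarith : 1 - Real.cos θ ≠ 0) hs hv) ?_)
  · have := congrFun h 0
    simp [hpos] at this
  · rw [hv, dotProduct_smul, smul_eq_mul]
    refine mul_lt_mul_of_pos_right hlt ?_
    exact lt_of_le_of_ne (Finset.sum_nonneg fun i _ => mul_self_nonneg _)
      fun h => hv0 (dotProduct_self_eq_zero.1 h.symm)

/-- A cosine truncated after its last positive value has Rayleigh quotient below `1 - cos θ`. -/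
theorem truncated_cos_energy_lt {n M : ℕ} {θ : ℝ} (hn : n + 1 < M)
    (hpos : 0 < Real.cos (n * θ)) (hneg : Real.cos ((n + 1 : ℕ) * θ) < 0) {c : ℕ → ℝ}
    (hc : c = fun i => if i < n + 1 then Real.cos (i * θ) else 0) :
    ∑ i ∈ range M, c i * (loopPathDeg (n + 1) M i * c i - pathNbr M c i +
      loopWeight (n + 1) i * c i) <
      ∑ i ∈ range M, (1 - Real.cos θ) * (loopPathDeg (n + 1) M i * (c i * c i)) := by
  have hcos : ∀ i < n + 1, c i = Real.cos (i * θ) := fun i hi => by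
    rw [hc]; exact if_pos hi
  have hzero : ∀ i, n + 1 ≤ i → c i = 0 := fun i hi => by
    rw [hc]; exact if_neg (not_lt.2 hi)
  have hrec : ∀ i : ℕ, Real.cos (i * θ) + Real.cos ((i + 1 + 1 : ℕ) * θ) =
      2 * Real.cos θ * Real.cos ((i + 1 : ℕ) * θ) := fun i => by
    have h1 : (i : ℝ) * θ = (i + 1 : ℕ) * θ - θ := by push_cast; ring
    have h2 : ((i + 1 + 1 : ℕ) : ℝ) * θ = (i + 1 : ℕ) * θ + θ := by push_cast; ring
    rw [h1, h2, Real.cos_sub, Real.cos_add]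
    ring
  have hle : ∀ i < n, c i * (loopPathDeg (n + 1) M i * c i - pathNbr M c i +
      loopWeight (n + 1) i * c i) = (1 - Real.cos θ) * (loopPathDeg (n + 1) M i * (c i * c i)) := by
    intro i hi
    have hloop : loopWeight (n + 1) i = 0 := if_neg (by omega)
    rw [loopPathDeg, hloop]
    unfold pathNbr
    rw [hcos i (by omega), hcos (i + 1) (by omega)]
    rcases i with _ | i
    · simp [show 1 < M by omega]
    · rw [Nat.add_sub_cancel, hcos i (by omega)]
      simp only [show i + 1 + 1 < M by omega, if_true, if_neg (Nat.succ_ne_zero i)]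
      linear_combination (-Real.cos ((i + 1 : ℕ) * θ)) * hrec i
  have hlt : c n * (loopPathDeg (n + 1) M n * c n - pathNbr M c n +
      loopWeight (n + 1) n * c n) < (1 - Real.cos θ) * (loopPathDeg (n + 1) M n * (c n * c n)) := by
    have hloop : loopWeight (n + 1) n = 0 := if_neg (by omega)
    rw [loopPathDeg, hloop]
    unfold pathNbr
    rw [hcos n (by omega), hzero (n + 1) le_rfl]
    rcases n with _ | n
    · simp [show 1 < M by omega] at hneg ⊢
      linarith
    · rw [Nat.add_sub_cancel, hcos n (by omega)]
      simp only [show n + 1 + 1 < M by omega, if_true, if_neg (Nat.succ_ne_zero n)]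
      nlinarith [hrec n, mul_pos hpos (neg_pos.2 hneg)]
  refine Finset.sum_lt_sum (fun i _ => ?_) ⟨n, by rw [Finset.mem_range]; omega, hlt⟩
  rcases lt_trichotomy i n with h | rfl | h
  · exact (hle i h).le
  · exact hlt.le
  · simp [hzero i h]

theorem sortedEig_one_roachW_lt {N n k : ℕ} (hN : N = n + 1) (hk : 1 ≤ k) {θ : ℝ}
    (hcos : Real.cos θ < 1) (hpos : 0 < Real.cos (n * θ)) (hneg : Real.cos ((n + 1 : ℕ) * θ) < 0)
    (hA : (normLap (roachW N k)).IsHermitian) (h1 : 1 < 2 * (N + k)) :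
    sortedEig hA ⟨1, h1⟩ < 1 - Real.cos θ := by
  subst hN
  have hW := wdeg_roachW_pos (n := n + 1) (k := k) (by omega)
  set M := n + 1 + k with hM
  set c : ℕ → ℝ := fun i => if i < n + 1 then Real.cos (i * θ) else 0 with hc
  set φ : ℕ → ℝ := fun i => if i < M then c i else -c (i - M) with hφ
  have hφ1 : ∀ i < M, φ i = c i := fun i hi => by simp [hφ, hi]
  have hφ2 : ∀ i, φ (M + i) = -c i := fun i => by simp [hφ]
  have hnbr : ∀ i < M, pathNbr M φ i = pathNbr M c i := fun i hi => by
    unfold pathNbr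
    rw [hφ1 (i - 1) (by omega)]
    split_ifs with h <;> first | rw [hφ1 _ h] | rfl
  have hs := normLap_mulVec_sqrt_wdeg hW
  have hsplit : ∀ g : ℕ → ℝ, ∑ j : Fin (2 * M), g j =
      ∑ i ∈ range M, g i + ∑ i ∈ range M, g (M + i) := fun g => by
    rw [Fin.sum_univ_eq_sum_range, two_mul, Finset.sum_range_add]
  refine sortedEig_one_lt_of_test hA (by omega) (by linarith) (fun h => ?_) hs
    (v := fun j => √(wdeg (roachW (n + 1) k) j) * φ j) ?_ ?_
  · have := congrFun h ⟨0, by omega⟩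
    simp [(Real.sqrt_pos.2 (hW _)).ne'] at this
  · rw [dotProduct_sqrt_wdeg hW (fun _ => 1) (fun j => φ j)]
    simp only [wdeg_roachW]
    rw [hsplit (fun j => loopPathDeg (n + 1) M (if j < M then j else j - M) * (1 * φ j)),
      ← Finset.sum_add_distrib]
    refine Finset.sum_eq_zero fun i hi => ?_
    rw [Finset.mem_range] at hi
    simp [hi, hφ1, hφ2]
  · rw [dotProduct_normLap_mulVec_sqrt hW (fun j => φ j),
      dotProduct_sqrt_wdeg hW (fun j => φ j) (fun j => φ j)]
    simp only [wdeg_roachW, sum_roachW_mul]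
    rw [hsplit (fun j => loopPathDeg (n + 1) M (if j < M then j else j - M) * (φ j * φ j)),
      hsplit (fun j => φ j * (loopPathDeg (n + 1) M (if j < M then j else j - M) * φ j -
        if j < M then pathNbr M φ j + loopWeight (n + 1) j * φ (M + j) else
          pathNbr M (fun i => φ (M + i)) (j - M) + loopWeight (n + 1) (j - M) * φ (j - M)))]
    have h := truncated_cos_energy_lt (M := M) (by omega) hpos hneg hc
    rw [← Finset.mul_sum] at h
    have h1 : ∀ i ∈ range M, φ i * (loopPathDeg (n + 1) M (if i < M then i else i - M) * φ i -
        if i < M then pathNbr M φ i + loopWeight (n + 1) i * φ (M + i) else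
          pathNbr M (fun i => φ (M + i)) (i - M) + loopWeight (n + 1) (i - M) * φ (i - M)) =
        c i * (loopPathDeg (n + 1) M i * c i - pathNbr M c i + loopWeight (n + 1) i * c i) := by
      intro i hi
      rw [Finset.mem_range] at hi
      rw [if_pos hi, if_pos hi, hφ1 i hi, hφ2, hnbr i hi]
      ring
    have h2 : ∀ i ∈ range M,
        φ (M + i) * (loopPathDeg (n + 1) M (if M + i < M then M + i else M + i - M) * φ (M + i) -
        if M + i < M then pathNbr M φ (M + i) + loopWeight (n + 1) (M + i) * φ (M + (M + i)) else
          pathNbr M (fun i => φ (M + i)) (M + i - M) +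
            loopWeight (n + 1) (M + i - M) * φ (M + i - M)) =
        c i * (loopPathDeg (n + 1) M i * c i - pathNbr M c i + loopWeight (n + 1) i * c i) := by
      intro i hi
      rw [Finset.mem_range] at hi
      rw [if_neg (by omega), if_neg (by omega), Nat.add_sub_cancel_left, hφ1 i hi]
      simp only [hφ2]
      rw [pathNbr_neg]
      ring
    have h3 : ∀ i ∈ range M, loopPathDeg (n + 1) M (if i < M then i else i - M) * (φ i * φ i) =
        loopPathDeg (n + 1) M i * (c i * c i) := by
      intro i hi
      rw [Finset.mem_range] at hi
      rw [if_pos hi, hφ1 i hi]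
    have h4 : ∀ i ∈ range M,
        loopPathDeg (n + 1) M (if M + i < M then M + i else M + i - M) *
          (φ (M + i) * φ (M + i)) = loopPathDeg (n + 1) M i * (c i * c i) := by
      intro i hi
      rw [if_neg (by omega), Nat.add_sub_cancel_left, hφ2]
      ring
    rw [Finset.sum_congr rfl h1, Finset.sum_congr rfl h2, Finset.sum_congr rfl h3,
      Finset.sum_congr rfl h4]
    linarith

/-- A nonpositive second eigenvalue would contradict connectedness of the roach graph. -/
theorem sortedEig_one_roachW_pos {n k : ℕ} (hk : 1 ≤ k) (h : 2 ≤ n + k)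
    (hΓ : ∀ μ ≤ 0, ∃ Γ, IsFluxSupersolution n (n + k) μ Γ)
    (hA : (normLap (roachW n k)).IsHermitian) (h1 : 1 < 2 * (n + k)) :
    0 < sortedEig hA ⟨1, h1⟩ := by
  by_contra! hle
  refine not_forall_eigenvector_mem_line hA h1
    (fun j => √(wdeg (roachW n k) j)) fun μ hμ v hv => ?_
  obtain ⟨F, rfl⟩ := exists_eq_sqrt_wdeg_mul (wdeg_roachW_pos h) v
  obtain ⟨hsym, hanti⟩ := normLap_roachW_eigenvector_parts h hv
  obtain ⟨Γ, hΓ⟩ := hΓ μ (hμ.trans hle)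
  have h1 := hsym.eq_const h hΓ
  have h2 := hanti.eq_zero_of_nonpos h (by omega) (hμ.trans hle)
  have h3 : ∀ i < n + k, F i = F 0 ∧ F (n + k + i) = F 0 := fun i hi => by
    have e1 := h1 i hi
    have e2 := h2 i hi
    have e3 := h2 0 (by omega)
    constructor <;> linarith
  refine ⟨F 0, funext fun j => ?_⟩
  have : F j = F 0 := by
    obtain ⟨j, hj⟩ := j
    rcases Nat.lt_or_ge j (n + k) with hj' | hj'
    · exact (h3 j hj').1
    · obtain ⟨i, rfl⟩ := Nat.exists_eq_add_of_le hj'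
      exact (h3 i (by omega)).2
  rw [this, Pi.smul_apply, smul_eq_mul, mul_comm]

/-- For small positive eigenvalues, an eigenvector of the roach graph is antisymmetric and
determined by its value at the first vertex. -/
theorem roachW_eigenvector_eq_zero {n k : ℕ} (h : 2 ≤ n + k) {μ : ℝ} (hμ : 0 < μ)
    {Γ : ℕ → ℝ} (hΓ : IsFluxSupersolution n (n + k) μ Γ) {v : Fin (2 * (n + k)) → ℝ}
    (hv : (normLap (roachW n k)).mulVec v = μ • v) (h0 : 0 < 2 * (n + k))
    (hv0 : v ⟨0, h0⟩ = 0) : v = 0 := by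
  obtain ⟨F, rfl⟩ := exists_eq_sqrt_wdeg_mul (wdeg_roachW_pos h) v
  obtain ⟨hsym, hanti⟩ := normLap_roachW_eigenvector_parts h hv
  have hF0 : F 0 = 0 :=
    (mul_eq_zero.1 hv0).resolve_left (Real.sqrt_pos.2 (wdeg_roachW_pos h _)).ne'
  have h1 := hsym.eq_const h hΓ
  have hM : 0 < n + k := by omega
  have hc : F 0 + F (n + k + 0) = 0 := by
    have e := hsym.pathFlux_sub hM
    rw [pathFlux_eq_sub _ (by omega), h1 (0 + 1) (by omega)] at e
    simp only [pathFlux, lt_irrefl, false_and, if_false, sub_self] at e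
    exact (mul_eq_zero.1 ((mul_eq_zero.1 e.symm).resolve_left
      (loopPathDeg_pos h 0).ne')).resolve_left hμ.ne'
  have h2 := hanti.eq_zero (by linarith)
  have h3 : ∀ i < n + k, F i = 0 ∧ F (n + k + i) = 0 := fun i hi => by
    have e1 := h1 i hi
    have e2 := h2 i hi
    constructor <;> linarith
  funext ⟨j, hj⟩
  have : F j = 0 := by
    rcases Nat.lt_or_ge j (n + k) with hj' | hj'
    · exact (h3 j hj').1
    · obtain ⟨i, rfl⟩ := Nat.exists_eq_add_of_le hj'
      exact (h3 i (by omega)).2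
  simp [this]


/-- For `k ≥ 3`: (1) `λ₂(𝓛(P_{4k})) < λ₂(𝓛(P_{2k,k}))`;
(2) `λ₂(𝓛(R_{2k,k})) < λ₂(𝓛(P_{4k}))`; and
(3) the second smallest eigenvalue of `𝓛(R_{2k,k})` is simple. -/
theorem roach_second_eigenvalue (k : ℕ) (hk : 3 ≤ k)
    (hP : (normLap (pathW (4 * k))).IsHermitian)
    (hQ : (normLap (wpathW (2 * k) k)).IsHermitian)
    (hR : (normLap (roachW (2 * k) k)).IsHermitian) :
    sortedEig hP ⟨1, by omega⟩ < sortedEig hQ ⟨1, by omega⟩ ∧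
    sortedEig hR ⟨1, by omega⟩ < sortedEig hP ⟨1, by omega⟩ ∧
    (∃ u : Fin (2 * (2 * k + k)) → ℝ, u ≠ 0 ∧
      (normLap (roachW (2 * k) k)).mulVec u = sortedEig hR ⟨1, by omega⟩ • u ∧
      ∀ v : Fin (2 * (2 * k + k)) → ℝ,
        (normLap (roachW (2 * k) k)).mulVec v = sortedEig hR ⟨1, by omega⟩ • v →
        ∃ c : ℝ, v = c • u) := by
  have hk' : (3 : ℝ) ≤ k := by exact_mod_cast hk
  obtain ⟨θ, hθ⟩ : ∃ θ : ℝ, (4 * k - 1) * θ = Real.pi :=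
    ⟨Real.pi / (4 * k - 1), mul_div_cancel₀ _ (by linarith)⟩
  have hθ0 : 0 < θ := by
    by_contra! h
    nlinarith [Real.pi_pos]
  have hcos : Real.cos θ < 1 := by
    have := Real.cos_lt_cos_of_nonneg_of_le_pi le_rfl (y := θ) (by nlinarith) hθ0
    rwa [Real.cos_zero] at this
  have hPeq : sortedEig hP ⟨1, by omega⟩ = 1 - Real.cos θ := by
    obtain ⟨m, hm⟩ : ∃ m, 4 * k = m + 1 := ⟨4 * k - 1, by omega⟩
    have hmθ : m * θ = Real.pi := by
      rw [← hθ, show (m : ℝ) = 4 * k - 1 by rw [eq_sub_iff_add_eq]; exact_mod_cast hm.symm]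
    exact le_antisymm (sortedEig_one_pathW_le hm (by omega) hmθ hcos hP _)
      (le_sortedEig_one_pathW hm (by omega) hmθ hP _)
  have hRlt : sortedEig hR ⟨1, by omega⟩ < 1 - Real.cos θ := by
    obtain ⟨n, hn⟩ : ∃ n, 2 * k = n + 1 := ⟨2 * k - 1, by omega⟩
    have hn' : (n : ℝ) = 2 * k - 1 := by rw [eq_sub_iff_add_eq]; exact_mod_cast hn.symm
    have hpos : 0 < Real.cos (n * θ) := by
      refine Real.cos_pos_of_mem_Ioo ⟨?_, ?_⟩ <;> rw [hn', ← hθ] <;> nlinarith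
    have hneg : Real.cos ((n + 1 : ℕ) * θ) < 0 := by
      refine Real.cos_neg_of_pi_div_two_lt_of_lt ?_ ?_ <;> push_cast <;> rw [hn', ← hθ] <;>
        nlinarith
    exact sortedEig_one_roachW_lt hn (by omega) hcos hpos hneg hR _
  have hRpos : 0 < sortedEig hR ⟨1, by omega⟩ :=
    sortedEig_one_roachW_pos (by omega) (by omega)
      (fun μ hμ => ⟨_, isFluxSupersolution_loopPath hk hθ (by linarith)⟩) hR _
  have hzero := fun v hv => roachW_eigenvector_eq_zero (v := v) (by omega) hRpos
    (isFluxSupersolution_loopPath hk hθ hRlt.le) hv (by omega)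
  refine ⟨hPeq ▸ lt_sortedEig_one_wpathW hk hθ hQ _, hPeq ▸ hRlt, ?_⟩
  obtain ⟨u, hu, hAu⟩ := exists_eigenvector_sortedEig hR ⟨1, by omega⟩
  refine ⟨u, hu, hAu, fun v hv => ⟨v ⟨0, by omega⟩ / u ⟨0, by omega⟩, ?_⟩⟩
  have hu0 : u ⟨0, by omega⟩ ≠ 0 := fun h => hu (hzero u hAu h)
  refine sub_eq_zero.1 (hzero _ ?_ ?_)
  · rw [Matrix.mulVec_sub, Matrix.mulVec_smul, hv, hAu, smul_sub, smul_comm]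
  · simp [hu0]
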